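/- Let n ≥ 2 and let Q(x₁,…,xₙ) = γ·(a₁^ρ·x₁^ρ + ⋯ + aₙ^ρ·xₙ^ρ)^{d/ρ} be a generalized ACMS (CES) production function on ℝⁿ₊, with γ, a₁,…,aₙ > 0, ρ ≠ 0, and d ≠ 0, d ≠ 1, and let F : ℝ₊ → ℝ₊ be twice continuously differentiable with F′ > 0 everywhere. Then the homothetic function f = F ∘ Q satisfies det(f_ij) = 0 at every point of ℝⁿ₊ if and only if either (1) ρ = 1, or (2) there exist real numbers α ≠ 0 and β such that F(u) = α·u^{1/d} + β on the range of Q, so that up to constants f(x) = γ̃·(a₁^ρ·x₁^ρ + ⋯ + aₙ^ρ·xₙ^ρ)^{1/ρ} for some γ̃ > 0. -/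

import Mathlib

open Real

/-- Partial derivative of `f` in the `i`-th coordinate direction. -/
noncomputable def pd {n : ℕ} (i : Fin n) (f : (Fin n → ℝ) → ℝ) (x : Fin n → ℝ) : ℝ :=
  fderiv ℝ f x (Pi.single i 1)

/-- Hessian matrix of second partial derivatives of `f` at `x`. -/
noncomputable def hess {n : ℕ} (f : (Fin n → ℝ) → ℝ) (x : Fin n → ℝ) :
    Matrix (Fin n) (Fin n) ℝ :=
  fun i j => pd i (pd j f) x

/-- Hessian determinant `det(f_ij)` of `f` at `x`. -/
noncomputable def hessDet {n : ℕ} (f : (Fin n → ℝ) → ℝ) (x : Fin n → ℝ) : ℝ :=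
  (hess f x).det

/-- The open positive orthant `ℝⁿ₊`. -/
def posOrth (n : ℕ) : Set (Fin n → ℝ) := {x | ∀ i, 0 < x i}

lemma aux_isOpen (n : ℕ) : IsOpen (posOrth n) := by
  have : posOrth n = ⋂ i : Fin n, {x | 0 < x i} := by
    ext x; simp [posOrth]
  rw [this]
  exact isOpen_iInter_of_finite fun i => isOpen_lt continuous_const (continuous_apply i)

lemma aux_S_pos {n : ℕ} (hn : 2 ≤ n) (b : Fin n → ℝ) (hb : ∀ i, 0 < b i) (ρ : ℝ)
    {x : Fin n → ℝ} (hx : x ∈ posOrth n) : 0 < ∑ i, b i * x i ^ ρ := by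
  apply Finset.sum_pos
  · intro i _
    exact mul_pos (hb i) (rpow_pos_of_pos (hx i) _)
  · exact ⟨⟨0, by omega⟩, Finset.mem_univ _⟩

lemma aux_S_surj {n : ℕ} (hn : 2 ≤ n) (b : Fin n → ℝ) (hb : ∀ i, 0 < b i) (ρ : ℝ) (hρ : ρ ≠ 0)
    {s : ℝ} (hs : 0 < s) : ∃ x ∈ posOrth n, ∑ i, b i * x i ^ ρ = s := by
  have hn' : (0 : ℝ) < n := by exact_mod_cast (by omega : 0 < n)
  have hpos : ∀ i, 0 < s / (n * b i) := fun i => div_pos hs (mul_pos hn' (hb i))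
  refine ⟨fun i => (s / (n * b i)) ^ (1 / ρ), fun i => rpow_pos_of_pos (hpos i) _, ?_⟩
  have : ∀ i ∈ (Finset.univ : Finset (Fin n)),
      b i * ((s / (n * b i)) ^ (1 / ρ)) ^ ρ = s / n := by
    intro i _
    rw [← rpow_mul (hpos i).le, one_div_mul_cancel hρ, rpow_one]
    have := (hb i).ne'
    field_simp
  rw [Finset.sum_congr rfl this]
  simp
  field_simp

lemma aux_S_deriv {n : ℕ} (b : Fin n → ℝ) (ρ : ℝ)
    {x : Fin n → ℝ} (hx : x ∈ posOrth n) :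
    HasFDerivAt (fun y : Fin n → ℝ => ∑ i, b i * y i ^ ρ)
      (∑ i, (b i * (ρ * x i ^ (ρ - 1))) •
        (ContinuousLinearMap.proj (R := ℝ) (φ := fun _ : Fin n => ℝ) i)) x := by
  apply HasFDerivAt.fun_sum
  intro i _
  have h1 : HasDerivAt (fun t : ℝ => b i * t ^ ρ) (b i * (ρ * x i ^ (ρ - 1))) (x i) :=
    (Real.hasDerivAt_rpow_const (Or.inl (hx i).ne')).const_mul (b i)
  exact HasDerivAt.comp_hasFDerivAt x (h₂ := fun t : ℝ => b i * t ^ ρ) h1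
    (hasFDerivAt_apply (𝕜 := ℝ) i x)

lemma aux_pd {n : ℕ} (hn : 2 ≤ n) (b : Fin n → ℝ) (hb : ∀ i, 0 < b i) (ρ : ℝ)
    (G G1 : ℝ → ℝ) (hG : ∀ s, 0 < s → HasDerivAt G (G1 s) s)
    {x : Fin n → ℝ} (hx : x ∈ posOrth n) (j : Fin n) :
    pd j (fun y => G (∑ i, b i * y i ^ ρ)) x
      = G1 (∑ i, b i * x i ^ ρ) * (b j * (ρ * x j ^ (ρ - 1))) := by
  have h := (hG _ (aux_S_pos hn b hb ρ hx)).comp_hasFDerivAt x (aux_S_deriv b ρ hx)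
  have h' : fderiv ℝ (fun y : Fin n → ℝ => G (∑ i, b i * y i ^ ρ)) x = _ := h.fderiv
  unfold pd
  rw [h']
  simp [Pi.single_apply]

lemma aux_hess {n : ℕ} (hn : 2 ≤ n) (b : Fin n → ℝ) (hb : ∀ i, 0 < b i) (ρ : ℝ)
    (G G1 G2 : ℝ → ℝ) (hG : ∀ s, 0 < s → HasDerivAt G (G1 s) s)
    (hG1 : ∀ s, 0 < s → HasDerivAt G1 (G2 s) s)
    {x : Fin n → ℝ} (hx : x ∈ posOrth n) (i j : Fin n) :
    hess (fun y => G (∑ i, b i * y i ^ ρ)) x i j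
      = G2 (∑ i, b i * x i ^ ρ) * (b i * (ρ * x i ^ (ρ - 1))) * (b j * (ρ * x j ^ (ρ - 1)))
        + if i = j then G1 (∑ i, b i * x i ^ ρ) *
            (b j * (ρ * ((ρ - 1) * x j ^ (ρ - 1 - 1)))) else 0 := by
  have hev : pd j (fun y : Fin n → ℝ => G (∑ i, b i * y i ^ ρ)) =ᶠ[nhds x]
      (fun y => G1 (∑ i, b i * y i ^ ρ) * (b j * (ρ * y j ^ (ρ - 1)))) := by
    filter_upwards [(aux_isOpen n).mem_nhds hx] with y hy
    exact aux_pd hn b hb ρ G G1 hG hy j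
  have h1 : HasFDerivAt (fun y : Fin n → ℝ => G1 (∑ i, b i * y i ^ ρ)) _ x :=
    (hG1 _ (aux_S_pos hn b hb ρ hx)).comp_hasFDerivAt x (aux_S_deriv b ρ hx)
  have h2 : HasFDerivAt (fun y : Fin n → ℝ => b j * (ρ * y j ^ (ρ - 1))) _ x :=
    HasDerivAt.comp_hasFDerivAt x (h₂ := fun t : ℝ => b j * (ρ * t ^ (ρ - 1)))
      (((Real.hasDerivAt_rpow_const (Or.inl (hx j).ne')).const_mul ρ).const_mul (b j))
      (hasFDerivAt_apply (𝕜 := ℝ) j x)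
  have h3 := (h1.mul h2).fderiv
  show fderiv ℝ (pd j (fun y : Fin n → ℝ => G (∑ i, b i * y i ^ ρ))) x (Pi.single i 1) = _
  rw [hev.fderiv_eq]
  have h4 : fderiv ℝ (fun y : Fin n → ℝ =>
    G1 (∑ i, b i * y i ^ ρ) * (b j * (ρ * y j ^ (ρ - 1)))) x = _ := h3
  rw [h4]
  by_cases hij : i = j
  · subst hij
    simp [Pi.single_apply]
    ring
  · have hji : ¬ j = i := fun h => hij h.symm
    simp [Pi.single_apply, hij, hji]
    ring

lemma aux_det {n : ℕ} (k : ℝ) (v D : Fin n → ℝ) (hD : ∀ i, D i ≠ 0)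
    (M : Matrix (Fin n) (Fin n) ℝ)
    (hM : ∀ i j, M i j = k * v i * v j + if i = j then D j else 0) :
    M.det = (∏ i, D i) * (1 + ∑ i, k * v i ^ 2 / D i) := by
  have : M = Matrix.diagonal D *
      (1 + Matrix.replicateCol Unit (fun i => k * v i / D i) * Matrix.replicateRow Unit v) := by
    ext i j
    rw [Matrix.diagonal_mul, hM]
    have := hD i
    by_cases hij : i = j
    · subst hij
      simp [Matrix.mul_apply]
      field_simp
      ring
    · simp [Matrix.mul_apply, hij]
      field_simp
  rw [this, Matrix.det_mul, Matrix.det_diagonal, Matrix.det_one_add_replicateCol_mul_replicateRow]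
  congr 2
  unfold dotProduct
  apply Finset.sum_congr rfl
  intro i _
  ring

lemma aux_hessDet_one {n : ℕ} (hn : 2 ≤ n) (b : Fin n → ℝ) (hb : ∀ i, 0 < b i)
    (G G1 G2 : ℝ → ℝ) (hG : ∀ s, 0 < s → HasDerivAt G (G1 s) s)
    (hG1 : ∀ s, 0 < s → HasDerivAt G1 (G2 s) s)
    {x : Fin n → ℝ} (hx : x ∈ posOrth n) :
    hessDet (fun y => G (∑ i, b i * y i ^ (1 : ℝ))) x = 0 := by
  unfold hessDet
  have hM := aux_hess hn b hb 1 G G1 G2 hG hG1 hx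
  set M := hess (fun y => G (∑ i, b i * y i ^ (1 : ℝ))) x
  simp only [sub_self, zero_mul, mul_zero, ite_self, add_zero, rpow_zero, mul_one] at hM
  generalize G2 (∑ i, b i * x i ^ (1 : ℝ)) = k at hM
  have hne : (⟨0, by omega⟩ : Fin n) ≠ ⟨1, by omega⟩ := by simp
  have hM2 : M = Matrix.vecMulVec (fun i => k * b i) b := by
    ext i j
    rw [hM]; rfl
  have : Nontrivial (Fin n) := ⟨_, _, hne⟩
  rw [hM2]
  exact Matrix.det_vecMulVec _ _

lemma aux_hessDet {n : ℕ} (hn : 2 ≤ n) (b : Fin n → ℝ) (hb : ∀ i, 0 < b i) (ρ : ℝ)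
    (hρ : ρ ≠ 0) (hρ1 : ρ ≠ 1)
    (G G1 G2 : ℝ → ℝ) (hG : ∀ s, 0 < s → HasDerivAt G (G1 s) s)
    (hG1 : ∀ s, 0 < s → HasDerivAt G1 (G2 s) s) (hne : ∀ s, 0 < s → G1 s ≠ 0)
    {x : Fin n → ℝ} (hx : x ∈ posOrth n) :
    hessDet (fun y => G (∑ i, b i * y i ^ ρ)) x = 0 ↔
      (ρ - 1) * G1 (∑ i, b i * x i ^ ρ)
        + ρ * (∑ i, b i * x i ^ ρ) * G2 (∑ i, b i * x i ^ ρ) = 0 := by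
  have hS := aux_S_pos hn b hb ρ hx
  have h1 := hne _ hS
  have hr : ρ - 1 ≠ 0 := sub_ne_zero.mpr hρ1
  have hD : ∀ j, G1 (∑ i, b i * x i ^ ρ) * (b j * (ρ * ((ρ - 1) * x j ^ (ρ - 1 - 1)))) ≠ 0 := by
    intro j
    exact mul_ne_zero h1 (mul_ne_zero (hb j).ne' (mul_ne_zero hρ (mul_ne_zero hr
      (rpow_pos_of_pos (hx j) _).ne')))
  unfold hessDet
  rw [aux_det _ _ _ hD _ (aux_hess hn b hb ρ G G1 G2 hG hG1 hx),
    mul_eq_zero, or_iff_right (Finset.prod_ne_zero_iff.mpr fun i _ => hD i)]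
  have hsum : ∑ j, G2 (∑ i, b i * x i ^ ρ) * (b j * (ρ * x j ^ (ρ - 1))) ^ 2 /
      (G1 (∑ i, b i * x i ^ ρ) * (b j * (ρ * ((ρ - 1) * x j ^ (ρ - 1 - 1)))))
      = G2 (∑ i, b i * x i ^ ρ) * ρ / (G1 (∑ i, b i * x i ^ ρ) * (ρ - 1)) *
        (∑ i, b i * x i ^ ρ) := by
    generalize G2 (∑ i, b i * x i ^ ρ) = k2 at *
    generalize G1 (∑ i, b i * x i ^ ρ) = k1 at *
    rw [Finset.mul_sum]
    apply Finset.sum_congr rfl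
    intro j _
    have hxj := hx j
    have e1 : x j ^ ρ = x j ^ (ρ - 1 - 1) * x j * x j := by
      rw [← rpow_add_one hxj.ne', ← rpow_add_one hxj.ne']; congr 1; ring
    have e2 : x j ^ (ρ - 1) = x j ^ (ρ - 1 - 1) * x j := by
      rw [← rpow_add_one hxj.ne']; congr 1; ring
    rw [e1, e2]
    have := (rpow_pos_of_pos hxj (ρ - 1 - 1)).ne'
    have := (hb j).ne'
    have := hxj.ne'
    field_simp
  rw [hsum]
  generalize G2 (∑ i, b i * x i ^ ρ) = k2 at *
  generalize G1 (∑ i, b i * x i ^ ρ) = k1 at *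
  generalize (∑ i, b i * x i ^ ρ) = S at *
  have : 1 + k2 * ρ / (k1 * (ρ - 1)) * S = ((ρ - 1) * k1 + ρ * S * k2) / (k1 * (ρ - 1)) := by
    field_simp
  rw [this, div_eq_zero_iff, or_iff_left (mul_ne_zero h1 hr)]

lemma aux_const (K : ℝ → ℝ) (hK : ∀ s, 0 < s → HasDerivAt K 0 s) {s : ℝ} (hs : 0 < s) :
    K s = K 1 := by
  apply (convex_Ioi (0 : ℝ)).is_const_of_fderivWithin_eq_zero (𝕜 := ℝ) (f := K) _ _ hs
    (by simp : (1 : ℝ) ∈ Set.Ioi (0 : ℝ))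
  · intro t ht
    exact (hK t ht).differentiableAt.differentiableWithinAt
  · intro t ht
    rw [fderivWithin_of_isOpen isOpen_Ioi ht]
    have := (hK t ht).hasFDerivAt.fderiv
    rw [this]; ext; simp

lemma aux_ode (ρ : ℝ) (hρ : ρ ≠ 0)
    (G G1 G2 : ℝ → ℝ) (hG : ∀ s, 0 < s → HasDerivAt G (G1 s) s)
    (hG1 : ∀ s, 0 < s → HasDerivAt G1 (G2 s) s)
    (hode : ∀ s, 0 < s → (ρ - 1) * G1 s + ρ * s * G2 s = 0) :
    ∃ β, ∀ s, 0 < s → G s = G1 1 * ρ * s ^ (1 / ρ) + β := by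
  have hK : ∀ s, 0 < s → G1 s = G1 1 * s ^ (1 / ρ - 1) := by
    intro s hs
    have := aux_const (fun s => G1 s * s ^ (1 - 1 / ρ)) (by
      intro t ht
      have h := (hG1 t ht).mul (Real.hasDerivAt_rpow_const (p := 1 - 1 / ρ) (Or.inl ht.ne'))
      refine HasDerivAt.congr_deriv h ?_
      have e : t ^ (1 - 1 / ρ) = t ^ (1 - 1 / ρ - 1) * t := by
        rw [← rpow_add_one ht.ne']; congr 1; ring
      rw [e]
      have e2 := hode t ht
      have e3 : G2 t * t + G1 t * (1 - 1 / ρ) = 0 := by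
        field_simp
        linarith
      linear_combination (t ^ (1 - 1 / ρ - 1)) * e3) hs
    simp only [one_rpow, mul_one] at this
    rw [← this, mul_assoc, ← rpow_add hs]
    simp
  refine ⟨G 1 - G1 1 * ρ, fun s hs => ?_⟩
  have := aux_const (fun s => G s - G1 1 * ρ * s ^ (1 / ρ)) (by
    intro t ht
    have h := (hG t ht).sub ((Real.hasDerivAt_rpow_const (p := 1 / ρ) (Or.inl ht.ne')).const_mul
      (G1 1 * ρ))
    refine HasDerivAt.congr_deriv h ?_
    rw [hK t ht]
    field_simp
    ring) hs
  simp only [one_rpow, mul_one] at this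
  linarith

lemma aux_ode_conv (ρ : ℝ) (hρ : ρ ≠ 0) (c β : ℝ)
    (G G1 G2 : ℝ → ℝ) (hG : ∀ s, 0 < s → HasDerivAt G (G1 s) s)
    (hG1 : ∀ s, 0 < s → HasDerivAt G1 (G2 s) s)
    (h : ∀ s, 0 < s → G s = c * s ^ (1 / ρ) + β) :
    ∀ s, 0 < s → (ρ - 1) * G1 s + ρ * s * G2 s = 0 := by
  have h1 : ∀ s, 0 < s → G1 s = c * (1 / ρ * s ^ (1 / ρ - 1)) := by
    intro s hs
    have h2 := ((Real.hasDerivAt_rpow_const (p := 1 / ρ) (Or.inl hs.ne')).const_mul c).add_const β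
    refine (hG s hs).unique (h2.congr_of_eventuallyEq ?_)
    filter_upwards [isOpen_Ioi.mem_nhds hs] with t ht
    exact h t ht
  intro s hs
  have h2 : G2 s = c * (1 / ρ * ((1 / ρ - 1) * s ^ (1 / ρ - 1 - 1))) := by
    have h2 := ((Real.hasDerivAt_rpow_const (p := 1 / ρ - 1) (Or.inl hs.ne')).const_mul
      (1 / ρ)).const_mul c
    refine (hG1 s hs).unique (h2.congr_of_eventuallyEq ?_)
    filter_upwards [isOpen_Ioi.mem_nhds hs] with t ht
    exact h1 t ht
  have e : s ^ (1 / ρ - 1) = s ^ (1 / ρ - 1 - 1) * s := by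
    rw [← rpow_add_one hs.ne']; congr 1; ring
  rw [h1 s hs, h2, e]
  field_simp
  ring

/-- Let `Q(x) = γ·(∑ᵢ aᵢ^ρ·xᵢ^ρ)^{d/ρ}` be a generalized ACMS (CES)
production function (`γ, aᵢ > 0`, `ρ ≠ 0`, `d ≠ 0`, `d ≠ 1`), and let `F : ℝ₊ → ℝ₊` be
C² with `F′ > 0` everywhere. Then `f = F ∘ Q` satisfies `det(f_ij) = 0` on `ℝⁿ₊` iff
either (1) `ρ = 1`, or (2) there exist `c ≠ 0` and `β` with `F(u) = c·u^{1/d} + β` on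
the range of `Q`, so that up to constants `f(x) = γ̃·(∑ᵢ aᵢ^ρ·xᵢ^ρ)^{1/ρ}` for some
`γ̃ > 0`. -/
theorem stmt_8 {n : ℕ} (hn : 2 ≤ n) (γ : ℝ) (hγ : 0 < γ)
    (a : Fin n → ℝ) (ha : ∀ i, 0 < a i)
    (ρ : ℝ) (hρ : ρ ≠ 0) (d : ℝ) (hd0 : d ≠ 0) (hd1 : d ≠ 1)
    (F : ℝ → ℝ) (hFC2 : ContDiffOn ℝ 2 F (Set.Ioi (0 : ℝ)))
    (hFpos : ∀ u : ℝ, 0 < u → 0 < F u)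
    (hF' : ∀ u : ℝ, 0 < u → 0 < deriv F u) :
    (∀ x ∈ posOrth n,
        hessDet (fun y => F (γ * (∑ i, a i ^ ρ * y i ^ ρ) ^ (d / ρ))) x = 0) ↔
      (ρ = 1 ∨
       (∃ c β : ℝ, c ≠ 0 ∧
          (∀ u ∈ (fun x : Fin n → ℝ => γ * (∑ i, a i ^ ρ * x i ^ ρ) ^ (d / ρ)) ''
              posOrth n, F u = c * u ^ (1 / d) + β) ∧
          ∃ γt : ℝ, 0 < γt ∧ ∀ x ∈ posOrth n,
            F (γ * (∑ i, a i ^ ρ * x i ^ ρ) ^ (d / ρ)) - β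
              = γt * (∑ i, a i ^ ρ * x i ^ ρ) ^ (1 / ρ))) := by
  have hb : ∀ i, 0 < a i ^ ρ := fun i => rpow_pos_of_pos (ha i) _
  set b : Fin n → ℝ := fun i => a i ^ ρ with hbdef
  set G : ℝ → ℝ := fun s => F (γ * s ^ (d / ρ)) with hGdef
  have hu : ∀ s : ℝ, 0 < s → 0 < γ * s ^ (d / ρ) := fun s hs =>
    mul_pos hγ (rpow_pos_of_pos hs _)
  have hGC : ContDiffOn ℝ 2 G (Set.Ioi 0) := by
    refine hFC2.comp (t := Set.Ioi 0) ?_ (fun s hs => hu s hs)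
    intro s hs
    exact (contDiffAt_const.mul (Real.contDiffAt_rpow_const_of_ne
      (ne_of_gt hs))).contDiffWithinAt
  have hG : ∀ s, 0 < s → HasDerivAt G (deriv G s) s := fun s hs =>
    ((hGC.differentiableOn (by norm_num)).differentiableAt (isOpen_Ioi.mem_nhds hs)).hasDerivAt
  have hGC1 : ContDiffOn ℝ 1 (deriv G) (Set.Ioi 0) :=
    hGC.deriv_of_isOpen isOpen_Ioi (by norm_num)
  have hG1 : ∀ s, 0 < s → HasDerivAt (deriv G) (deriv (deriv G) s) s := fun s hs =>
    ((hGC1.differentiableOn (by norm_num)).differentiableAt (isOpen_Ioi.mem_nhds hs)).hasDerivAt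
  have hne : ∀ s, 0 < s → deriv G s ≠ 0 := by
    intro s hs
    have hF1 : HasDerivAt F (deriv F (γ * s ^ (d / ρ))) (γ * s ^ (d / ρ)) :=
      ((hFC2.differentiableOn (by norm_num)).differentiableAt
        (isOpen_Ioi.mem_nhds (hu s hs))).hasDerivAt
    have h := HasDerivAt.comp s hF1
      ((Real.hasDerivAt_rpow_const (p := d / ρ) (Or.inl hs.ne')).const_mul γ)
    have h' : deriv G s = _ := h.deriv
    rw [h']
    exact mul_ne_zero (hF' _ (hu s hs)).ne' (mul_ne_zero hγ.ne'
      (mul_ne_zero (div_ne_zero hd0 hρ) (rpow_pos_of_pos hs _).ne'))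
  by_cases hρ1 : ρ = 1
  · refine ⟨fun _ => Or.inl hρ1, fun _ x hx => ?_⟩
    have h := aux_hessDet_one hn b hb G _ _ hG hG1 hx
    rw [← hρ1] at h
    exact h
  have key : (∀ x ∈ posOrth n,
        hessDet (fun y => F (γ * (∑ i, a i ^ ρ * y i ^ ρ) ^ (d / ρ))) x = 0) ↔
      ∀ s, 0 < s → (ρ - 1) * deriv G s + ρ * s * deriv (deriv G) s = 0 := by
    constructor
    · intro h s hs
      obtain ⟨x, hx, rfl⟩ := aux_S_surj hn b hb ρ hρ hs
      exact (aux_hessDet hn b hb ρ hρ hρ1 G _ _ hG hG1 hne hx).1 (h x hx)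
    · intro h x hx
      exact (aux_hessDet hn b hb ρ hρ hρ1 G _ _ hG hG1 hne hx).2
        (h _ (aux_S_pos hn b hb ρ hx))
  rw [key]
  constructor
  · intro hode
    right
    obtain ⟨β, hβ⟩ := aux_ode ρ hρ G _ _ hG hG1 hode
    have hc1 : deriv G 1 * ρ ≠ 0 := mul_ne_zero (hne 1 one_pos) hρ
    generalize deriv G 1 * ρ = c1 at hβ hc1
    have hc : 0 < c1 := by
      by_contra hcon
      have hneg : c1 < 0 := lt_of_le_of_ne (not_lt.mp hcon) hc1
      have hT : 0 < (|β| + 1) / (-c1) := div_pos (by positivity) (by linarith)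
      have h1 := hβ _ (rpow_pos_of_pos hT ρ)
      rw [← rpow_mul hT.le, mul_one_div_cancel hρ, rpow_one] at h1
      have h2 : c1 * ((|β| + 1) / (-c1)) = -(|β| + 1) := by field_simp
      rw [h2] at h1
      have h3 : 0 < G (((|β| + 1) / (-c1)) ^ ρ) :=
        hFpos _ (hu _ (rpow_pos_of_pos hT ρ))
      have := le_abs_self β
      linarith
    have hg : 0 < γ ^ (1 / d) := rpow_pos_of_pos hγ _
    refine ⟨c1 / γ ^ (1 / d), β, (div_pos hc hg).ne', ?_, c1, hc, ?_⟩
    · rintro u ⟨x, hx, rfl⟩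
      have hS := aux_S_pos hn b hb ρ hx
      have h1 := hβ _ hS
      have h2 : (γ * (∑ i, b i * x i ^ ρ) ^ (d / ρ)) ^ (1 / d)
          = γ ^ (1 / d) * (∑ i, b i * x i ^ ρ) ^ (1 / ρ) := by
        rw [mul_rpow hγ.le (rpow_pos_of_pos hS _).le, ← rpow_mul hS.le]
        congr 2
        field_simp
      show G (∑ i, b i * x i ^ ρ) =
        c1 / γ ^ (1 / d) * (γ * (∑ i, b i * x i ^ ρ) ^ (d / ρ)) ^ (1 / d) + β
      rw [h2, h1]
      field_simp
    · intro x hx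
      have h1 := hβ _ (aux_S_pos hn b hb ρ hx)
      show G (∑ i, b i * x i ^ ρ) - β = c1 * (∑ i, b i * x i ^ ρ) ^ (1 / ρ)
      linarith
  · rintro (h | ⟨c, β, -, -, γt, -, h⟩)
    · exact absurd h hρ1
    · apply aux_ode_conv ρ hρ γt β G _ _ hG hG1
      intro s hs
      obtain ⟨x, hx, rfl⟩ := aux_S_surj hn b hb ρ hρ hs
      have h1 : G (∑ i, b i * x i ^ ρ) - β = γt * (∑ i, b i * x i ^ ρ) ^ (1 / ρ) := h x hx
      linarith
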